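/- For every k ≥ 1, every finite k-edge-connected undirected graph G with destination t ∈ V admits a routing process that is ⌊k/2⌋-resilient against dynamic failures. -/

import Mathlib

namespace FRR

open scoped Classical

variable {V : Type*} [Fintype V] [DecidableEq V]

/-- `G` is `k`-edge-connected: removing any set of at most `k-1` edges keeps it connected. -/
def EdgeConnected (G : SimpleGraph V) (k : ℕ) : Prop :=
  ∀ F : Set (Sym2 V), F ⊆ G.edgeSet → F.ncard ≤ k - 1 → (G.deleteEdges F).Connected


/-- A (basic, deterministic) forwarding scheme on `G`: given the current node, the
in-port (the neighbor the packet arrived from, `none` for a freshly originated packet)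
and the set of currently active neighbors, it selects an active neighbor to forward to. -/
structure FwdScheme (G : SimpleGraph V) where
  fwd : V → Option V → Set V → V
  mem : ∀ (v : V) (ip : Option V) (A : Set V), A.Nonempty → fwd v ip A ∈ A

/-- The packet trajectory (current node, in-port) of a forwarding scheme with
destination `t`, started at `s`, under the failure schedule `σ`; the packet is
absorbed at `t` and gets stuck when no incident link is active. -/
noncomputable def FwdScheme.traj {G : SimpleGraph V} (P : FwdScheme G)
    (σ : ℕ → Set (Sym2 V)) (t s : V) : ℕ → V × Option V
  | 0 => (s, none)
  | n + 1 =>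
    let p := FwdScheme.traj P σ t s n
    if p.1 = t then p
    else if ({u : V | G.Adj p.1 u ∧ s(p.1, u) ∉ σ n} : Set V).Nonempty then
      (P.fwd p.1 p.2 {u : V | G.Adj p.1 u ∧ s(p.1, u) ∉ σ n}, some p.1)
    else p

/-- A forwarding scheme for destination `t` is `r`-resilient against dynamic failures:
for every unstable-link set `F` with `|F| ≤ r`, every (dynamic, i.e. arbitrary) failure
schedule `σ` on `F` whose induced trajectory satisfies the non-trap assumption, and
every source `s` connected to `t` in `G ∖ F`, the packet reaches `t` in finitely
many steps. -/
def DynResilient {G : SimpleGraph V} (P : FwdScheme G) (t : V) (r : ℕ) : Prop :=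
  ∀ F : Set (Sym2 V), F ⊆ G.edgeSet → F.ncard ≤ r →
    ∀ σ : ℕ → Set (Sym2 V), (∀ n, σ n ⊆ F) →
      ∀ s : V,
        (∀ n, (G.deleteEdges F).Reachable (P.traj σ t s n).1 (P.traj σ t s (n + 1)).1) →
        (G.deleteEdges F).Reachable s t →
        ∃ n, (P.traj σ t s n).1 = t

/-- Number of arcs of `A` leaving `X`. -/
def outC (A : Finset (V × V)) (X : Finset V) : ℕ :=
  (A.filter (fun p => p.1 ∈ X ∧ p.2 ∉ X)).card

lemma outC_submod (A : Finset (V × V)) (X Y : Finset V) :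
    outC A (X ∩ Y) + outC A (X ∪ Y) ≤ outC A X + outC A Y := by
  unfold outC
  simp only [Finset.card_filter]
  rw [← Finset.sum_add_distrib, ← Finset.sum_add_distrib]
  apply Finset.sum_le_sum
  intro p _
  by_cases h1 : p.1 ∈ X <;> by_cases h2 : p.2 ∈ X <;> by_cases h3 : p.1 ∈ Y <;>
    by_cases h4 : p.2 ∈ Y <;> simp [h1, h2, h3, h4]

/-- Arcs of `A` not used by the partial arborescence `nxt` on `S`. -/
def resid (A : Finset (V × V)) (S : Finset V) (nxt : V → V) : Finset (V × V) :=
  A.filter (fun p => ¬ (p.1 ∈ S ∧ p.2 = nxt p.1))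

/-- Invariant of Lovász's growing procedure. -/
def TreeInv (A : Finset (V × V)) (t : V) (j : ℕ) (S : Finset V) (nxt : V → V)
    (rk : V → ℕ) : Prop :=
  t ∈ S ∧ (∀ v ∈ S, v ≠ t → (v, nxt v) ∈ A ∧ nxt v ∈ S ∧ rk (nxt v) < rk v) ∧
    ∀ X : Finset V, X.Nonempty → t ∉ X → j ≤ outC (resid A S nxt) X

lemma tree_grow (A : Finset (V × V)) (t : V) (j : ℕ)
    (hA : ∀ X : Finset V, X.Nonempty → t ∉ X → j + 1 ≤ outC A X)
    (S : Finset V) (nxt : V → V) (rk : V → ℕ) (hI : TreeInv A t j S nxt rk)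
    (hS : S ≠ Finset.univ) :
    ∃ u, u ∉ S ∧ ∃ nxt' rk', TreeInv A t j (insert u S) nxt' rk' := by
  obtain ⟨htS, htree, hout⟩ := hI
  set B := resid A S nxt with hB
  let P : Finset V → Prop := fun X =>
    (∃ u ∈ X, u ∉ S) ∧ (X = Finset.univ ∨ (t ∉ X ∧ outC B X = j))
  have hne : (Finset.univ.filter P).Nonempty := by
    refine ⟨Finset.univ, ?_⟩
    simp only [Finset.mem_filter, Finset.mem_univ, true_and]
    refine ⟨?_, Or.inl rfl⟩
    by_contra hcon
    push Not at hcon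
    exact hS (Finset.eq_univ_iff_forall.2 fun x => hcon x (Finset.mem_univ x))
  obtain ⟨X, hX, hmin⟩ := Finset.exists_min_image _ Finset.card hne
  simp only [Finset.mem_filter, Finset.mem_univ, true_and] at hX hmin
  obtain ⟨⟨u0, hu0X, hu0S⟩, hX2⟩ := hX
  have harc : ∃ u w, u ∈ X ∧ u ∉ S ∧ w ∈ X ∧ w ∈ S ∧ (u, w) ∈ B := by
    by_contra hcon
    push Not at hcon
    have h1 : outC B (X \ S) ≤ outC B X := by
      apply Finset.card_le_card
      rintro ⟨a, b⟩ hp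
      simp only [Finset.mem_filter, Finset.mem_sdiff] at hp ⊢
      refine ⟨hp.1, hp.2.1.1, fun hb => ?_⟩
      by_cases hbS : b ∈ S
      · exact hcon a b hp.2.1.1 hp.2.1.2 hb hbS hp.1
      · exact hp.2.2 ⟨hb, hbS⟩
    have h2 : outC A (X \ S) ≤ outC B (X \ S) := by
      apply Finset.card_le_card
      rintro ⟨a, b⟩ hp
      simp only [Finset.mem_filter, Finset.mem_sdiff, hB, resid] at hp ⊢
      exact ⟨⟨hp.1, fun h => hp.2.1.2 h.1⟩, hp.2⟩
    have h3 := hA (X \ S) ⟨u0, by simp [hu0X, hu0S]⟩ (by simp [htS])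
    have h4 : outC B X ≤ j := by
      rcases hX2 with h | h
      · subst h; simp [outC]
      · exact h.2.le
    omega
  obtain ⟨u, w, huX, huS, hwX, hwS, huw⟩ := harc
  have huw' : (u, w) ∈ A := (Finset.mem_filter.1 huw).1
  refine ⟨u, huS, Function.update nxt u w, Function.update rk u (rk w + 1), ?_, ?_, ?_⟩
  · simp [htS]
  · intro v hv hvt
    have hwu : w ≠ u := fun h => huS (h ▸ hwS)
    rcases Finset.mem_insert.1 hv with rfl | hv
    · simp [huw', hwS, Function.update_of_ne hwu]
    · have hvu : v ≠ u := fun h => huS (h ▸ hv)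
      obtain ⟨h1, h2, h3⟩ := htree v hv hvt
      have h4 : nxt v ≠ u := fun h => huS (h ▸ h2)
      rw [Function.update_of_ne hvu, Function.update_of_ne hvu, Function.update_of_ne h4]
      exact ⟨h1, by simp [h2], h3⟩
  · intro Y hY htY
    set B' := resid A (insert u S) (Function.update nxt u w) with hB'
    have hsub : B.erase (u, w) ⊆ B' := by
      rintro ⟨a, b⟩ hp
      simp only [Finset.mem_erase, hB, hB', resid, Finset.mem_filter, Finset.mem_insert] at hp ⊢
      refine ⟨hp.2.1, ?_⟩
      rintro ⟨h1, h2⟩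
      by_cases hau : a = u
      · subst hau
        simp at h2
        exact hp.1 (by rw [h2])
      · rw [Function.update_of_ne hau] at h2
        exact hp.2.2 ⟨h1.resolve_left hau, h2⟩
    by_cases hc : u ∈ Y ∧ w ∉ Y
    · have h1 : outC B Y ≤ outC B' Y + 1 := by
        have : B.filter (fun p => p.1 ∈ Y ∧ p.2 ∉ Y) ⊆
            insert (u, w) (B'.filter (fun p => p.1 ∈ Y ∧ p.2 ∉ Y)) := by
          intro p hp
          by_cases hpe : p = (u, w)
          · simp [hpe]
          · rw [Finset.mem_filter] at hp
            apply Finset.mem_insert_of_mem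
            rw [Finset.mem_filter]
            exact ⟨hsub (Finset.mem_erase.2 ⟨hpe, hp.1⟩), hp.2⟩
        exact (Finset.card_le_card this).trans (Finset.card_insert_le _ _)
      have h2 : outC B Y ≠ j := by
        intro hYj
        have hlt : (X ∩ Y).card < X.card := by
          apply Finset.card_lt_card
          refine ⟨Finset.inter_subset_left, fun h => hc.2 ?_⟩
          exact (Finset.mem_inter.1 (h hwX)).2
        have hP : P (X ∩ Y) := by
          refine ⟨⟨u, by simp [huX, hc.1], huS⟩, Or.inr ⟨by simp [htY], ?_⟩⟩
          rcases hX2 with h | h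
          · subst h; simpa using hYj
          · have hs := outC_submod B X Y
            have ha := hout (X ∩ Y) ⟨u, by simp [huX, hc.1]⟩ (by simp [htY])
            have hb := hout (X ∪ Y) ⟨u, by simp [huX]⟩ (by simp [htY, h.1])
            omega
        have := hmin _ hP
        omega
      have h3 := hout Y hY htY
      omega
    · refine (hout Y hY htY).trans (Finset.card_le_card ?_)
      intro p hp
      rw [Finset.mem_filter] at hp ⊢
      refine ⟨hsub (Finset.mem_erase.2 ⟨?_, hp.1⟩), hp.2⟩
      rintro rfl
      exact hc hp.2

lemma tree_exists (A : Finset (V × V)) (t : V) (j : ℕ)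
    (hA : ∀ X : Finset V, X.Nonempty → t ∉ X → j + 1 ≤ outC A X) :
    ∃ nxt rk, TreeInv A t j Finset.univ nxt rk := by
  have key : ∀ n : ℕ, ∀ S : Finset V, ∀ nxt rk, (Finset.univ \ S).card = n →
      TreeInv A t j S nxt rk → ∃ nxt rk, TreeInv A t j Finset.univ nxt rk := by
    intro n
    induction n with
    | zero =>
      intro S nxt rk hn hI
      have : S = Finset.univ := by
        rw [Finset.card_eq_zero, Finset.sdiff_eq_empty_iff_subset] at hn
        exact Finset.univ_subset_iff.1 hn
      subst this
      exact ⟨nxt, rk, hI⟩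
    | succ n ih =>
      intro S nxt rk hn hI
      have hS : S ≠ Finset.univ := by
        rintro rfl
        simp at hn
      obtain ⟨u, hu, nxt', rk', hI'⟩ := tree_grow A t j hA S nxt rk hI hS
      refine ih (insert u S) nxt' rk' ?_ hI'
      rw [Finset.sdiff_insert, Finset.card_erase_of_mem (by simp [hu])]
      omega
  refine key _ {t} id (fun _ => 0) rfl ⟨by simp, ?_, ?_⟩
  · intro v hv hvt
    simp at hv
    exact absurd hv hvt
  · intro X hX ht
    refine (Nat.le_succ j).trans ((hA X hX ht).trans (Finset.card_le_card ?_))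
    rintro ⟨a, b⟩ hp
    simp only [Finset.mem_filter, resid, Finset.mem_singleton] at hp ⊢
    refine ⟨⟨hp.1, ?_⟩, hp.2⟩
    rintro ⟨rfl, -⟩
    exact ht hp.2.1

/-- Edmonds' theorem on arc-disjoint in-arborescences rooted at `t`. -/
lemma edmonds (t : V) (m : ℕ) : ∀ A : Finset (V × V),
    (∀ X : Finset V, X.Nonempty → t ∉ X → m ≤ outC A X) →
    ∃ (nxt : ℕ → V → V) (rk : ℕ → V → ℕ),
      (∀ i < m, ∀ v, v ≠ t → (v, nxt i v) ∈ A ∧ rk i (nxt i v) < rk i v) ∧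
      (∀ i < m, ∀ j < m, ∀ v, v ≠ t → nxt i v = nxt j v → i = j) := by
  induction m with
  | zero => intro A _; exact ⟨fun _ => id, fun _ _ => 0, by simp, by simp⟩
  | succ m ih =>
    intro A hA
    obtain ⟨f, r, -, h1, h2⟩ := tree_exists A t m hA
    obtain ⟨nxt, rk, h3, h4⟩ := ih _ h2
    refine ⟨fun i => if i = m then f else nxt i, fun i => if i = m then r else rk i, ?_, ?_⟩
    · intro i hi v hv
      by_cases him : i = m
      · simp only [him, if_true]
        have := h1 v (Finset.mem_univ v) hv
        exact ⟨this.1, this.2.2⟩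
      · simp only [him, if_false]
        have := h3 i (by omega) v hv
        exact ⟨(Finset.mem_filter.1 this.1).1, this.2⟩
    · have hne : ∀ i < m, ∀ v, v ≠ t → nxt i v ≠ f v := by
        intro i hi v hv h
        have := (Finset.mem_filter.1 (h3 i hi v hv).1).2
        exact this ⟨Finset.mem_univ _, h⟩
      intro i hi j hj v hv hij
      by_cases him : i = m <;> by_cases hjm : j = m
      · omega
      · simp only [him, hjm, if_true, if_false] at hij
        exact absurd hij.symm (hne j (by omega) v hv)
      · simp only [him, hjm, if_true, if_false] at hij
        exact absurd hij (hne i (by omega) v hv)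
      · simp only [him, hjm, if_false] at hij
        exact h4 i (by omega) j (by omega) v hv hij

/-- Number of pairs of `D` inside `X`. -/
def inC (D : Finset (V × V)) (X : Finset V) : ℕ :=
  (D.filter (fun p => p.1 ∈ X ∧ p.2 ∈ X)).card

/-- Number of pairs of `D` with exactly one end in `X`. -/
def cutC (D : Finset (V × V)) (X : Finset V) : ℕ :=
  (D.filter (fun p => (p.1 ∈ X ∧ p.2 ∉ X) ∨ (p.1 ∉ X ∧ p.2 ∈ X))).card

lemma inC_supermod (D : Finset (V × V)) (X Y : Finset V) :
    inC D X + inC D Y ≤ inC D (X ∩ Y) + inC D (X ∪ Y) := by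
  unfold inC
  simp only [Finset.card_filter]
  rw [← Finset.sum_add_distrib, ← Finset.sum_add_distrib]
  apply Finset.sum_le_sum
  intro p _
  by_cases h1 : p.1 ∈ X <;> by_cases h2 : p.2 ∈ X <;> by_cases h3 : p.1 ∈ Y <;>
    by_cases h4 : p.2 ∈ Y <;> simp [h1, h2, h3, h4]

/-- Feasible (doubled) in-degree vectors. -/
def Feas (D : Finset (V × V)) (m : ℕ) (y : V → ℤ) : Prop :=
  (∑ v, y v = 2 * (D.card : ℤ)) ∧ ∀ X : Finset V, X.Nonempty → X ≠ Finset.univ →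
    2 * (inC D X : ℤ) + 2 * m ≤ ∑ v ∈ X, y v

/-- Tight sets. -/
def Tight (D : Finset (V × V)) (m : ℕ) (y : V → ℤ) (X : Finset V) : Prop :=
  X.Nonempty ∧ X ≠ Finset.univ ∧ ∑ v ∈ X, y v = 2 * (inC D X : ℤ) + 2 * m

lemma tight_uncross (D : Finset (V × V)) (m : ℕ) (y : V → ℤ) (hy : Feas D m y)
    (X Y : Finset V) (hX : Tight D m y X) (hY : Tight D m y Y) (h1 : (X ∩ Y).Nonempty)
    (h2 : X ∪ Y ≠ Finset.univ) : Tight D m y (X ∩ Y) ∧ Tight D m y (X ∪ Y) := by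
  have hu : (X ∪ Y).Nonempty := hX.1.mono Finset.subset_union_left
  have hi : X ∩ Y ≠ Finset.univ := by
    intro h
    apply hX.2.1
    exact Finset.univ_subset_iff.1 (h ▸ Finset.inter_subset_left)
  have a := hy.2 _ h1 hi
  have b := hy.2 _ hu h2
  have c := Finset.sum_union_inter (s₁ := X) (s₂ := Y) (f := y)
  have d := inC_supermod D X Y
  have e := hX.2.2
  have f := hY.2.2
  zify at d
  refine ⟨⟨h1, hi, by linarith⟩, ⟨hu, h2, by linarith⟩⟩

lemma two_odd (y : V → ℤ) (X : Finset V) (he : Even (∑ v ∈ X, y v)) (v : V) (hv : v ∈ X)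
    (ho : Odd (y v)) : ∃ u ∈ X, u ≠ v ∧ Odd (y u) := by
  by_contra hcon
  push Not at hcon
  rw [← Finset.add_sum_erase _ _ hv] at he
  have : Even (∑ x ∈ X.erase v, y x) := by
    apply Finset.even_sum
    intro u hu
    rw [Finset.mem_erase] at hu
    exact Int.not_odd_iff_even.1 (hcon u hu.2 hu.1)
  have h3 := ho.add_even this
  exact (Int.not_even_iff_odd.2 h3) he

lemma round_pair (D : Finset (V × V)) (m : ℕ) (y : V → ℤ) (hy : Feas D m y)
    (v0 : V) (hv0 : Odd (y v0)) :
    ∃ u v, u ≠ v ∧ Odd (y u) ∧ Odd (y v) ∧ ∀ Y, Tight D m y Y → v ∈ Y → u ∈ Y := by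
  by_contra hcon
  push Not at hcon
  have htot : Even (∑ v, y v) := by rw [hy.1]; exact even_two_mul _
  let P : Finset V → Prop := fun X =>
    (Tight D m y X ∨ Tight D m y Xᶜ) ∧ ∃ v ∈ X, Odd (y v)
  have hne : (Finset.univ.filter P).Nonempty := by
    obtain ⟨u, -, huv, hu⟩ := two_odd y Finset.univ htot v0 (Finset.mem_univ _) hv0
    obtain ⟨Y, hY, hv, -⟩ := hcon u v0 huv hu hv0
    exact ⟨Y, by simpa [P] using ⟨Or.inl hY, v0, hv, hv0⟩⟩
  obtain ⟨X, hX, hmin⟩ := Finset.exists_min_image _ Finset.card hne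
  simp only [Finset.mem_filter, Finset.mem_univ, true_and] at hX hmin
  obtain ⟨hX, v, hvX, hv⟩ := hX
  have heven : Even (∑ v ∈ X, y v) := by
    rcases hX with h | h
    · rw [h.2.2]
      exact (even_two_mul _).add (even_two_mul _)
    · have h1 := Finset.sum_add_sum_compl X y
      have h2 : ∑ v ∈ X, y v = ∑ v, y v - ∑ v ∈ Xᶜ, y v := by linarith
      rw [h2, h.2.2]
      exact htot.sub ((even_two_mul _).add (even_two_mul _))
  obtain ⟨u, huX, huv, hu⟩ := two_odd y X heven v hvX hv
  obtain ⟨Y, hY, hvY, huY⟩ := hcon u v huv hu hv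
  have small : ∀ Z : Finset V, Z ⊆ X → (u ∉ Z ∨ v ∉ Z) → P Z → False := by
    intro Z hZ hn hP
    have h1 := hmin Z hP
    have h2 : Z.card < X.card := by
      apply Finset.card_lt_card
      refine ⟨hZ, fun h => ?_⟩
      rcases hn with hn | hn
      · exact hn (h huX)
      · exact hn (h hvX)
    omega
  rcases hX with hT | hT
  · by_cases hU : X ∪ Y = Finset.univ
    · refine small Yᶜ ?_ (Or.inr (by simpa using hvY))
        ⟨Or.inr (by simpa using hY), u, by simpa using huY, hu⟩
      intro z hz
      have : z ∈ X ∪ Y := by simp [hU]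
      rcases Finset.mem_union.1 this with h | h
      · exact h
      · exact absurd h (by simpa using hz)
    · have := tight_uncross D m y hy X Y hT hY ⟨v, by simp [hvX, hvY]⟩ hU
      exact small (X ∩ Y) Finset.inter_subset_left (Or.inl (by simp [huY]))
        ⟨Or.inl this.1, v, by simp [hvX, hvY], hv⟩
  · by_cases hI : (Xᶜ ∩ Y).Nonempty
    · have hU : Xᶜ ∪ Y ≠ Finset.univ := by
        intro h
        have : u ∈ Xᶜ ∪ Y := by simp [h]
        simp [huX, huY] at this
      have := tight_uncross D m y hy Xᶜ Y hT hY hI hU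
      refine small (Xᶜ ∪ Y)ᶜ ?_ (Or.inr (by simp [hvY]))
        ⟨Or.inr (by simpa using this.2), u, by simp [huX, huY], hu⟩
      intro z hz
      simp at hz
      exact hz.1
    · refine small Y ?_ (Or.inl huY) ⟨Or.inl hY, v, hvY, hv⟩
      intro z hz
      by_contra hzX
      exact hI ⟨z, by simp [hz, hzX]⟩

lemma round_all (D : Finset (V × V)) (m : ℕ) : ∀ n : ℕ, ∀ y : V → ℤ, Feas D m y →
    (Finset.univ.filter (fun v => Odd (y v))).card = n →
    ∃ y', Feas D m y' ∧ ∀ v, Even (y' v) := by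
  intro n
  induction n using Nat.strong_induction_on with
  | _ n ih =>
    intro y hy hn
    by_cases hall : ∀ v, Even (y v)
    · exact ⟨y, hy, hall⟩
    push Not at hall
    obtain ⟨v0, hv0⟩ := hall
    rw [Int.not_even_iff_odd] at hv0
    obtain ⟨u, v, huv, hu, hv, hno⟩ := round_pair D m y hy v0 hv0
    let y' : V → ℤ := fun x => y x + ((if x = u then 1 else 0) - (if x = v then 1 else 0))
    have hsum : ∀ X : Finset V, ∑ x ∈ X, y' x =
        ∑ x ∈ X, y x + ((if u ∈ X then 1 else 0) - (if v ∈ X then 1 else 0)) := by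
      intro X
      simp only [y', Finset.sum_add_distrib, Finset.sum_sub_distrib, Finset.sum_ite_eq']
    have hy' : Feas D m y' := by
      constructor
      · rw [hsum, hy.1]; simp
      · intro X hX hXu
        rw [hsum]
        have h := hy.2 X hX hXu
        by_cases hvX : v ∈ X <;> by_cases huX : u ∈ X <;> simp only [hvX, huX, if_true, if_false]
        · linarith
        · have hne : ∑ v ∈ X, y v ≠ 2 * (inC D X : ℤ) + 2 * m :=
            fun h => huX (hno X ⟨hX, hXu, h⟩ hvX)
          omega
        · linarith
        · linarith
    refine ih _ ?_ y' hy' rfl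
    rw [← hn]
    apply Finset.card_lt_card
    refine ⟨?_, fun h => ?_⟩
    · intro x hx
      simp only [Finset.mem_filter, Finset.mem_univ, true_and] at hx ⊢
      by_cases hxu : x = u
      · rw [hxu]; exact hu
      by_cases hxv : x = v
      · rw [hxv]; exact hv
      simpa [y', hxu, hxv] using hx
    · have := h (show u ∈ _ by simpa using hu)
      simp only [Finset.mem_filter, Finset.mem_univ, true_and, y', if_true, huv, if_false] at this
      rw [sub_zero] at this
      exact (Int.not_even_iff_odd.2 this) (hu.add_odd odd_one)

lemma feas_init (D : Finset (V × V)) (m : ℕ)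
    (hcut : ∀ X : Finset V, X.Nonempty → X ≠ Finset.univ → 2 * m ≤ cutC D X) :
    ∃ y, Feas D m y := by
  have hs : ∀ X : Finset V, ∑ v ∈ X, (((D.filter (fun p => p.1 = v)).card : ℤ) +
      ((D.filter (fun p => p.2 = v)).card : ℤ)) = 2 * (inC D X : ℤ) + cutC D X := by
    intro X
    simp only [inC, cutC, Finset.card_filter]
    push_cast
    rw [Finset.sum_add_distrib, Finset.sum_comm, Finset.sum_comm (s := X), Finset.mul_sum,
      ← Finset.sum_add_distrib, ← Finset.sum_add_distrib]
    apply Finset.sum_congr rfl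
    intro p _
    simp only [Finset.sum_ite_eq]
    by_cases h1 : p.1 ∈ X <;> by_cases h2 : p.2 ∈ X <;> simp [h1, h2]
  refine ⟨fun v => ((D.filter (fun p => p.1 = v)).card : ℤ) +
      ((D.filter (fun p => p.2 = v)).card : ℤ), ?_, ?_⟩
  · rw [hs]; simp [inC, cutC]
  · intro X h1 h2
    rw [hs]
    have := hcut X h1 h2
    omega

lemma orient (D : Finset (V × V)) (m : ℕ)
    (hcut : ∀ X : Finset V, X.Nonempty → X ≠ Finset.univ → 2 * m ≤ cutC D X) :
    ∃ h : V × V → V, (∀ p ∈ D, h p = p.1 ∨ h p = p.2) ∧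
      ∀ X : Finset V, X.Nonempty → X ≠ Finset.univ →
        m ≤ (D.filter (fun p => h p ∈ X ∧ ¬ (p.1 ∈ X ∧ p.2 ∈ X))).card := by
  obtain ⟨y0, hy0⟩ := feas_init D m hcut
  obtain ⟨y, hy, hev⟩ := round_all D m _ y0 hy0 rfl
  choose z hz using hev
  have hsumz : ∀ X : Finset V, ∑ v ∈ X, y v = 2 * ∑ v ∈ X, z v := by
    intro X
    rw [Finset.mul_sum]
    exact Finset.sum_congr rfl fun v _ => by rw [hz v]; ring
  have htot : ∑ v, z v = D.card := by
    have h1 := hy.1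
    rw [hsumz] at h1
    omega
  have hge : ∀ X : Finset V, X.Nonempty → X ≠ Finset.univ → (inC D X : ℤ) + m ≤ ∑ v ∈ X, z v := by
    intro X h1 h2
    have h := hy.2 X h1 h2
    rw [hsumz] at h
    omega
  have hge' : ∀ X : Finset V, (inC D X : ℤ) ≤ ∑ v ∈ X, z v := by
    intro X
    rcases X.eq_empty_or_nonempty with rfl | h1
    · simp [inC]
    by_cases h2 : X = Finset.univ
    · rw [h2, htot]; simp [inC]
    · have := hge X h1 h2
      omega
  have hnn : ∀ v, 0 ≤ z v := by
    intro v
    have h := hge' {v}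
    simp only [Finset.sum_singleton] at h
    omega
  let x : V → ℕ := fun v => (z v).toNat
  have hx : ∀ X : Finset V, ((∑ v ∈ X, x v : ℕ) : ℤ) = ∑ v ∈ X, z v := by
    intro X
    push_cast
    exact Finset.sum_congr rfl fun v _ => by simp [x, hnn v]
  let slots : Finset V → Finset (Σ v : V, Fin (x v)) := fun X => X.sigma fun _ => Finset.univ
  have hslots : ∀ X, (slots X).card = ∑ v ∈ X, x v := by
    intro X
    simp [slots, Finset.card_sigma]
  let tt : D → Finset (Σ v : V, Fin (x v)) := fun p => slots {p.1.1, p.1.2}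
  have hall : ∀ s : Finset D, s.card ≤ (s.biUnion tt).card := by
    intro s
    let X : Finset V := s.biUnion fun p => {p.1.1, p.1.2}
    have h1 : s.biUnion tt = slots X := by
      ext q
      simp [tt, slots, X]
    rw [h1, hslots]
    have h2 : s.card ≤ inC D X := by
      rw [← Finset.card_map (Function.Embedding.subtype _)]
      apply Finset.card_le_card
      intro p hp
      simp only [Finset.mem_map, Function.Embedding.subtype_apply] at hp
      obtain ⟨q, hq, rfl⟩ := hp
      rw [Finset.mem_filter]
      refine ⟨q.2, ?_, ?_⟩ <;>
      · simp only [X, Finset.mem_biUnion]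
        exact ⟨q, hq, by simp⟩
    have h3 := hge' X
    rw [← hx] at h3
    omega
  obtain ⟨f, hfi, hft⟩ := (Finset.all_card_le_biUnion_card_iff_exists_injective tt).1 hall
  let h : V × V → V := fun p => if hp : p ∈ D then (f ⟨p, hp⟩).1 else p.1
  have hle : ∀ X : Finset V, (D.filter (fun p => h p ∈ X)).card ≤ ∑ v ∈ X, x v := by
    intro X
    rw [← hslots, ← Finset.card_attach (s := D.filter (fun p => h p ∈ X))]
    refine Finset.card_le_card_of_injOn
      (fun p => f ⟨p.1, (Finset.mem_filter.1 p.2).1⟩) ?_ ?_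
    · intro p _
      have hp := Finset.mem_filter.1 p.2
      have h2 := hp.2
      simp only [h, hp.1, dif_pos] at h2
      simp only [slots, Finset.coe_sigma, Finset.mem_coe, Finset.mem_sigma, Finset.mem_univ]
      simpa using h2
    · intro p _ q _ hpq
      have := hfi hpq
      simp only [Subtype.mk.injEq] at this
      exact Subtype.ext this
  refine ⟨h, ?_, ?_⟩
  · intro p hp
    have := hft ⟨p, hp⟩
    simp only [tt, slots, Finset.mem_sigma, Finset.mem_insert, Finset.mem_singleton,
      Finset.mem_univ, and_true] at this
    simpa [h, hp] using this
  · intro X h1 h2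
    have a := hle Xᶜ
    have b := Finset.card_filter_add_card_filter_not (s := D) (fun p => h p ∈ X)
    have b' : (D.filter (fun p => h p ∈ Xᶜ)).card = (D.filter (fun p => ¬ h p ∈ X)).card := by
      simp
    have c := hge X h1 h2
    have d := Finset.sum_add_sum_compl X z
    have e := hx Xᶜ
    have g : (D.filter (fun p => h p ∈ X)).card ≤
        (D.filter (fun p => h p ∈ X ∧ ¬ (p.1 ∈ X ∧ p.2 ∈ X))).card + inC D X := by
      rw [inC]
      refine le_trans (Finset.card_le_card ?_) (Finset.card_union_le _ _)
      intro p hp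
      simp only [Finset.mem_union, Finset.mem_filter] at hp ⊢
      tauto
    omega

/-- The family of arborescences used for routing: trees `0..m-1` (left) and `m..2m-1` (right),
arc-disjoint, with each half link-disjoint. -/
structure Trees (G : SimpleGraph V) (t : V) (m : ℕ) (nxt : ℕ → V → V) (rk : ℕ → V → ℕ) :
    Prop where
  adj : ∀ i < 2 * m, ∀ v, v ≠ t → G.Adj v (nxt i v)
  rank : ∀ i < 2 * m, ∀ v, v ≠ t → rk i (nxt i v) < rk i v
  inj : ∀ i < 2 * m, ∀ j < 2 * m, ∀ v, v ≠ t → nxt i v = nxt j v → i = j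
  left : ∀ i < m, ∀ j < m, ∀ v w, v ≠ t → w ≠ t → s(v, nxt i v) = s(w, nxt j w) → i = j
  right : ∀ i < 2 * m, m ≤ i → ∀ j < 2 * m, m ≤ j → ∀ v w, v ≠ t → w ≠ t →
    s(v, nxt i v) = s(w, nxt j w) → i = j

/-- Bouncing condition from tree `c` at `v` to tree `m`. -/
def Jump (t : V) (m : ℕ) (nxt : ℕ → V → V) (v : V) (c : ℕ) : Prop :=
  c < m ∧ nxt c v ≠ t ∧ nxt m (nxt c v) = v

/-- Next tree to try at `v` when the link of tree `c` is down. -/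
noncomputable def switch (t : V) (m : ℕ) (nxt : ℕ → V → V) (v : V) (c : ℕ) : ℕ :=
  if Jump t m nxt v c then m else if c + 1 = 2 * m then 0 else c + 1

/-- Elementary steps of the routing process: move along the current tree or switch. -/
def Step (t : V) (m : ℕ) (nxt : ℕ → V → V) (F : Set (Sym2 V)) (p q : V × ℕ) : Prop :=
  p.1 ≠ t ∧ p.2 < 2 * m ∧
    ((q.1 = nxt p.2 p.1 ∧ q.2 = p.2) ∨
      (s(p.1, nxt p.2 p.1) ∈ F ∧ q.1 = p.1 ∧ q.2 = switch t m nxt p.1 p.2))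

lemma pigeon {F : Set (Sym2 V)} {m : ℕ} (hF : F.ncard ≤ m) (φ : Fin m → Sym2 V)
    (hφ : Function.Injective φ) (hm : ∀ i, φ i ∈ F) : ∀ e ∈ F, ∃ i, φ i = e := by
  have h1 : (Set.range φ) ⊆ F := by rintro _ ⟨i, rfl⟩; exact hm i
  have h2 : (Set.range φ).ncard = m := by
    rw [← Set.image_univ, Set.ncard_image_of_injective _ hφ, Set.ncard_univ]; simp
  have h3 : Set.range φ = F := Set.eq_of_subset_of_ncard_le h1 (by omega) (Set.toFinite F)
  intro e he
  rw [← h3] at he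
  exact he

lemma no_infinite {G : SimpleGraph V} {t : V} {m : ℕ} {nxt : ℕ → V → V} {rk : ℕ → V → ℕ}
    (hT : Trees G t m nxt rk) {F : Set (Sym2 V)} (hF : F.ncard ≤ m)
    (p : ℕ → V × ℕ) (hp : ∀ n, Step t m nxt F (p n) (p (n + 1))) : False := by
  have hm : 0 < m := by have := (hp 0).2.1; omega
  -- the first switch after time `n`
  have first : ∀ n, ∃ n', n ≤ n' ∧ (p n').2 = (p n).2 ∧ rk (p n).2 (p n').1 ≤ rk (p n).2 (p n).1 ∧
      s((p n').1, nxt (p n').2 (p n').1) ∈ F ∧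
      (p (n' + 1)).1 = (p n').1 ∧ (p (n' + 1)).2 = switch t m nxt (p n').1 (p n').2 := by
    have aux : ∀ r n, rk (p n).2 (p n).1 = r → ∃ n', n ≤ n' ∧ (p n').2 = (p n).2 ∧
      rk (p n).2 (p n').1 ≤ rk (p n).2 (p n).1 ∧
      s((p n').1, nxt (p n').2 (p n').1) ∈ F ∧
      (p (n' + 1)).1 = (p n').1 ∧ (p (n' + 1)).2 = switch t m nxt (p n').1 (p n').2 := by
      intro r
      induction r using Nat.strong_induction_on with
      | _ r ih =>
        intro n hr
        obtain ⟨h1, h2, h3⟩ := hp n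
        rcases h3 with ⟨h3, h4⟩ | ⟨h3, h4, h5⟩
        · have hlt := hT.rank _ h2 _ h1
          rw [← h3] at hlt
          obtain ⟨n', a, b, c, d⟩ := ih (rk (p (n+1)).2 (p (n+1)).1) (by rw [h4, ← hr]; exact hlt)
            (n + 1) rfl
          rw [h4] at b c
          exact ⟨n', by omega, b, by omega, d⟩
        · exact ⟨n, le_rfl, rfl, le_rfl, h3, h4, h5⟩
    exact fun n => aux _ n rfl
  -- every right tree is reached
  have reachm : ∀ n, ∃ n', n ≤ n' ∧ (p n').2 = m := by
    have aux : ∀ r n, (if (p n).2 ≤ m then m - (p n).2 else 3 * m - (p n).2) = r →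
        ∃ n', n ≤ n' ∧ (p n').2 = m := by
      intro r
      induction r using Nat.strong_induction_on with
      | _ r ih =>
        intro n hr
        by_cases hc : (p n).2 = m
        · exact ⟨n, le_rfl, hc⟩
        obtain ⟨n', a, b, -, -, -, e⟩ := first n
        have hlt := (hp n).2.1
        rw [switch] at e
        by_cases hj : Jump t m nxt (p n').1 (p n').2
        · rw [if_pos hj] at e
          exact ⟨n' + 1, by omega, e⟩
        · rw [if_neg hj, b] at e
          obtain ⟨n'', h1, h2⟩ := ih _ (by rw [← hr, e]; split_ifs <;> omega) (n' + 1) rfl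
          exact ⟨n'', by omega, h2⟩
    exact fun n => aux _ n rfl
  have reachR : ∀ d, d < m → ∀ n, ∃ n', n ≤ n' ∧ (p n').2 = m + d := by
    intro d
    induction d with
    | zero => intro _ n; exact reachm n
    | succ d ih =>
      intro hd n
      obtain ⟨n1, h1, h2⟩ := ih (by omega) n
      obtain ⟨n', a, b, -, -, -, e⟩ := first n1
      have hj : ¬ Jump t m nxt (p n').1 (p n').2 := by
        intro h
        have := h.1
        omega
      rw [switch, if_neg hj, b, h2, if_neg (by omega)] at e
      exact ⟨n' + 1, by omega, by omega⟩
  have hRw : ∀ d : Fin m, ∃ v, v ≠ t ∧ s(v, nxt (m + d) v) ∈ F := by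
    intro d
    obtain ⟨n, -, hn⟩ := reachR d d.2 0
    obtain ⟨n', a, b, -, c, -⟩ := first n
    rw [b, hn] at c
    exact ⟨_, (hp n').1, c⟩
  choose vR hvR hvRF using hRw
  have surjR := pigeon hF (fun d : Fin m => s(vR d, nxt (m + d) (vR d))) (by
    intro d d' h
    have := hT.right (m + d) (by omega) (by omega) (m + d') (by omega) (by omega) _ _
      (hvR d) (hvR d') h
    exact Fin.ext (by omega)) hvRF
  -- tree `m` has a unique unstable link
  have uniq : ∀ v, v ≠ t → s(v, nxt m v) ∈ F →
      s(v, nxt m v) = s(vR ⟨0, hm⟩, nxt m (vR ⟨0, hm⟩)) := by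
    intro v hv hvF
    obtain ⟨d, hd⟩ := surjR _ hvF
    have := hT.right (m + d) (by omega) (by omega) m (by omega) (by omega) _ _
      (hvR d) hv hd
    have hd0 : d = ⟨0, hm⟩ := Fin.ext (by simp; omega)
    subst hd0
    simpa using hd.symm
  -- no jump ever occurs
  have nojump : ∀ n, (s((p n).1, nxt (p n).2 (p n).1) ∈ F) → (p (n + 1)).1 = (p n).1 →
      (p (n + 1)).2 = switch t m nxt (p n).1 (p n).2 → ¬ Jump t m nxt (p n).1 (p n).2 := by
    intro n h1 h2 h3 hj
    rw [switch, if_pos hj] at h3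
    obtain ⟨hc, hwt, hw⟩ := hj
    obtain ⟨n', -, b, c, d, -⟩ := first (n + 1)
    rw [h3] at b c
    rw [b] at d
    have e1 := uniq _ (hp n').1 d
    have e2 := uniq _ hwt (by rw [hw, Sym2.eq_swap]; exact h1)
    rw [← e2, hw] at e1
    rw [h2] at c
    have hlt := hT.rank m (by omega) _ hwt
    rw [hw] at hlt
    rcases Sym2.eq_iff.1 e1 with ⟨e, -⟩ | ⟨e, e'⟩
    · rw [e] at c
      omega
    · rw [e] at e'
      have := hT.inj _ (hp n).2.1 m (by omega) _ (hp n).1 e'.symm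
      omega
  -- every left tree is reached, at a switch
  have reachL : ∀ d, d < m → ∃ n, (p n).2 = d := by
    intro d
    induction d with
    | zero =>
      intro _
      obtain ⟨n1, -, h2⟩ := reachR (m - 1) (by omega) 0
      obtain ⟨n', a, b, -, -, -, e⟩ := first n1
      have hj : ¬ Jump t m nxt (p n').1 (p n').2 := by
        intro h
        have := h.1
        omega
      rw [switch, if_neg hj, if_pos (by omega)] at e
      exact ⟨n' + 1, e⟩
    | succ d ih =>
      intro hd
      obtain ⟨n1, h1⟩ := ih (by omega)
      obtain ⟨n', a, b, -, c, e, f⟩ := first n1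
      have hj := nojump n' c e f
      rw [switch, if_neg hj, if_neg (by omega)] at f
      exact ⟨n' + 1, by omega⟩
  have hLw : ∀ d : Fin m, ∃ v, v ≠ t ∧ s(v, nxt d v) ∈ F ∧ ¬ Jump t m nxt v d := by
    intro d
    obtain ⟨n, hn⟩ := reachL d d.2
    obtain ⟨n', a, b, -, c, e, f⟩ := first n
    have hj := nojump n' c e f
    rw [b, hn] at c hj
    exact ⟨_, (hp n').1, c, hj⟩
  choose vL hvL hvLF hvLJ using hLw
  have surjL := pigeon hF (fun d : Fin m => s(vL d, nxt d (vL d))) (by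
    intro d d' h
    have := hT.left d d.2 d' d'.2 _ _ (hvL d) (hvL d') h
    exact Fin.ext (by omega)) hvLF
  obtain ⟨d, hd⟩ := surjL _ (hvRF ⟨0, hm⟩)
  simp only [Nat.add_zero] at hd
  rcases Sym2.eq_iff.1 hd with ⟨e, e'⟩ | ⟨e, e'⟩
  · rw [← e] at e'
    have := hT.inj d (by omega) m (by omega) _ (hvL d) e'
    omega
  · exact hvLJ d ⟨d.2, by rw [e']; exact hvR _, by rw [e', ← e]⟩

/-- Current tree, read off the in-port. -/
noncomputable def cur (t : V) (m : ℕ) (nxt : ℕ → V → V) (v : V) (ip : Option V) : ℕ :=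
  if h : ∃ w, ip = some w ∧ w ≠ t ∧ ∃ i < 2 * m, nxt i w = v then h.choose_spec.2.2.choose else 0

lemma cur_lt (t : V) (m : ℕ) (hm : 0 < m) (nxt : ℕ → V → V) (v : V) (ip : Option V) :
    cur t m nxt v ip < 2 * m := by
  unfold cur
  split_ifs with h
  · exact h.choose_spec.2.2.choose_spec.1
  · omega

lemma cur_eq {G : SimpleGraph V} {t : V} {m : ℕ} {nxt : ℕ → V → V} {rk : ℕ → V → ℕ}
    (hT : Trees G t m nxt rk) (w : V) (hw : w ≠ t) (i : ℕ) (hi : i < 2 * m) :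
    cur t m nxt (nxt i w) (some w) = i := by
  have h : ∃ w', some w = some w' ∧ w' ≠ t ∧ ∃ j < 2 * m, nxt j w' = nxt i w :=
    ⟨w, rfl, hw, i, hi, rfl⟩
  unfold cur
  rw [dif_pos h]
  have h1 : w = h.choose := Option.some.inj h.choose_spec.1
  have h2 := h.choose_spec.2.2.choose_spec
  refine hT.inj _ h2.1 _ hi w hw ?_
  exact (congrArg (nxt _) h1).trans h2.2

lemma switch_lt (t : V) (m : ℕ) (nxt : ℕ → V → V) (v : V) (c : ℕ) (hc : c < 2 * m) :
    switch t m nxt v c < 2 * m := by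
  unfold switch
  split_ifs <;> omega

lemma switch_iter_lt (t : V) (m : ℕ) (nxt : ℕ → V → V) (v : V) (c : ℕ) (hc : c < 2 * m) (n : ℕ) :
    (switch t m nxt v)^[n] c < 2 * m := by
  induction n with
  | zero => exact hc
  | succ n ih => rw [Function.iterate_succ_apply']; exact switch_lt _ _ _ _ _ ih

/-- The routing process. -/
noncomputable def scheme (G : SimpleGraph V) (t : V) (m : ℕ) (nxt : ℕ → V → V) : FwdScheme G where
  fwd v ip A :=
    if h : ∃ n, nxt ((switch t m nxt v)^[n] (cur t m nxt v ip)) v ∈ A then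
      nxt ((switch t m nxt v)^[Nat.find h] (cur t m nxt v ip)) v
    else if h' : A.Nonempty then h'.some else v
  mem v ip A hA := by
    split_ifs with h
    · exact Nat.find_spec h
    · exact hA.some_mem

lemma step_chain {α : Type*} (r : α → α → Prop) (f : ℕ → α)
    (hf : ∀ n, Relation.TransGen r (f n) (f (n + 1)))
    (hno : ∀ p : ℕ → α, (∀ n, r (p n) (p (n + 1))) → False) : False := by
  have hwf : WellFounded (fun a b => r b a) := by
    rw [wellFounded_iff_isEmpty_descending_chain]
    exact ⟨fun p => hno p.1 p.2⟩
  have hwf2 := hwf.transGen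
  have := wellFounded_iff_isEmpty_descending_chain.1 hwf2
  refine this.false ⟨f, fun n => ?_⟩
  have h := hf n
  rw [← Relation.transGen_swap] at h
  exact h

lemma scheme_resilient {G : SimpleGraph V} {t : V} {m : ℕ} {nxt : ℕ → V → V} {rk : ℕ → V → ℕ}
    (hm : 0 < m) (hT : Trees G t m nxt rk) : DynResilient (scheme G t m nxt) t m := by
  intro F _ hF σ hσ s _ _
  by_contra hcon
  push Not at hcon
  set T := (scheme G t m nxt).traj σ t s with hTdef
  refine step_chain (Step t m nxt F)
    (fun n => ((T n).1, cur t m nxt (T n).1 (T n).2)) ?_ (fun p hp => no_infinite hT hF p hp)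
  intro n
  have hvt := hcon n
  set v := (T n).1 with hv
  set c := cur t m nxt v (T n).2 with hc
  have hclt : c < 2 * m := cur_lt t m hm nxt v _
  set A : Set V := {u : V | G.Adj v u ∧ s(v, u) ∉ σ n} with hA
  have hmemA : ∀ i < 2 * m, nxt i v ∉ A → s(v, nxt i v) ∈ F := by
    intro i hi h
    apply hσ n
    by_contra hn
    exact h ⟨hT.adj i hi v hvt, hn⟩
  have hlt := switch_iter_lt t m nxt v c hclt
  have hex : ∃ k, nxt ((switch t m nxt v)^[k] c) v ∈ A := by
    by_contra hno
    push Not at hno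
    refine no_infinite hT hF (fun k => (v, (switch t m nxt v)^[k] c)) ?_
    intro k
    refine ⟨hvt, hlt k, Or.inr ⟨hmemA _ (hlt k) (hno k), rfl, ?_⟩⟩
    exact Function.iterate_succ_apply' _ _ _
  have hTn : T (n + 1) = (nxt ((switch t m nxt v)^[Nat.find hex] c) v, some v) := by
    have hne : A.Nonempty := ⟨_, hex.choose_spec⟩
    have h1 : T (n + 1) = ((scheme G t m nxt).fwd v (T n).2 A, some v) := by
      rw [hTdef, FwdScheme.traj]
      simp only [← hTdef]
      rw [if_neg hvt, if_pos hne]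
    rw [h1]
    simp only [scheme]
    rw [dif_pos hex]
    congr!
  have hsw : ∀ k, k ≤ Nat.find hex →
      Relation.ReflTransGen (Step t m nxt F) (v, c) (v, (switch t m nxt v)^[k] c) := by
    intro k
    induction k with
    | zero => intro _; exact Relation.ReflTransGen.refl
    | succ k ih =>
      intro hk
      refine (ih (by omega)).tail ⟨hvt, hlt k, Or.inr ⟨?_, rfl, ?_⟩⟩
      · exact hmemA _ (hlt k) (Nat.find_min hex (by omega))
      · exact Function.iterate_succ_apply' _ _ _
  have hlast := Relation.TransGen.tail' (hsw _ le_rfl)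
    (show Step t m nxt F _ (nxt ((switch t m nxt v)^[Nat.find hex] c) v,
      (switch t m nxt v)^[Nat.find hex] c) from ⟨hvt, hlt _, Or.inl ⟨rfl, rfl⟩⟩)
  rw [hTn]
  simp only
  rw [cur_eq hT v hvt _ (hlt _)]
  exact hlast


lemma cut_ge (G : SimpleGraph V) (k : ℕ) (hk : 1 ≤ k) (hconn : EdgeConnected G k)
    (D : Finset (V × V)) (hD : ∀ p ∈ D, G.Adj p.1 p.2)
    (hD2 : ∀ a b, G.Adj a b → (a, b) ∈ D ∨ (b, a) ∈ D)
    (X : Finset V) (hX : X.Nonempty) (hX2 : X ≠ Finset.univ) : k ≤ cutC D X := by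
  by_contra hlt
  push Not at hlt
  let C := D.filter (fun p => (p.1 ∈ X ∧ p.2 ∉ X) ∨ (p.1 ∉ X ∧ p.2 ∈ X))
  let F : Finset (Sym2 V) := C.image fun p => s(p.1, p.2)
  have hF : F.card ≤ k - 1 := by
    have : F.card ≤ C.card := Finset.card_image_le
    have h2 : C.card < k := hlt
    omega
  have hc := hconn (F : Set (Sym2 V)) (by
    intro e he
    simp only [F, Finset.coe_image, Set.mem_image, Finset.mem_coe] at he
    obtain ⟨p, hp, rfl⟩ := he
    exact hD p (Finset.mem_filter.1 hp).1) (by rw [Set.ncard_coe_finset]; exact hF)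
  obtain ⟨x, hx⟩ := hX
  obtain ⟨z, hz⟩ : ∃ z, z ∉ X := by
    by_contra h
    push Not at h
    exact hX2 (Finset.eq_univ_iff_forall.2 h)
  obtain ⟨w⟩ := hc.preconnected x z
  have : ∀ a b, (G.deleteEdges (F : Set (Sym2 V))).Walk a b → a ∈ X → b ∈ X := by
    intro a b w
    induction w with
    | nil => exact id
    | cons h _ ih =>
      intro ha
      apply ih
      by_contra hb
      rw [SimpleGraph.deleteEdges_adj] at h
      apply h.2
      simp only [F, Finset.coe_image, Set.mem_image, Finset.mem_coe]
      rcases hD2 _ _ h.1 with hd | hd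
      · exact ⟨_, Finset.mem_filter.2 ⟨hd, Or.inl ⟨ha, hb⟩⟩, rfl⟩
      · exact ⟨_, Finset.mem_filter.2 ⟨hd, Or.inr ⟨hb, ha⟩⟩, Sym2.eq_swap⟩
  exact hz (this x z w hx)

/-- Nash-Williams' weak orientation theorem. -/
lemma orientation (G : SimpleGraph V) (k : ℕ) (hk : 1 ≤ k) (hconn : EdgeConnected G k) :
    ∃ O : Finset (V × V), (∀ a b, (a, b) ∈ O → G.Adj a b ∧ (b, a) ∉ O) ∧
      ∀ X : Finset V, X.Nonempty → X ≠ Finset.univ → k / 2 ≤ outC O X := by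
  let f := Fintype.equivFin V
  let D : Finset (V × V) := Finset.univ.filter fun p => G.Adj p.1 p.2 ∧ f p.1 < f p.2
  have hD : ∀ p ∈ D, G.Adj p.1 p.2 ∧ f p.1 < f p.2 := fun p hp => (Finset.mem_filter.1 hp).2
  have hD2 : ∀ a b, G.Adj a b → (a, b) ∈ D ∨ (b, a) ∈ D := by
    intro a b hab
    have hne : f a ≠ f b := fun h => hab.ne (f.injective h)
    rcases lt_or_gt_of_ne hne with h | h
    · exact Or.inl (by simp [D, hab, h])
    · exact Or.inr (by simp [D, hab.symm, h])
  obtain ⟨h, h1, h2⟩ := orient D (k / 2) (fun X hX hX2 => by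
    have := cut_ge G k hk hconn D (fun p hp => (hD p hp).1) hD2 X hX hX2
    omega)
  let o : V × V → V × V := fun p => if h p = p.2 then p else (p.2, p.1)
  have ho : ∀ p, o p = p ∨ o p = (p.2, p.1) := by
    intro p
    simp only [o]
    split_ifs <;> simp
  have hinj : ∀ p ∈ D, ∀ q ∈ D, (o p = o q ∨ o p = ((o q).2, (o q).1)) → p = q := by
    intro p hp q hq hpq
    have a := (hD p hp).2
    have b := (hD q hq).2
    rcases ho p with e1 | e1 <;> rcases ho q with e2 | e2 <;> rw [e1, e2] at hpq <;>
      rcases hpq with hpq | hpq <;> (have c1 := congrArg Prod.fst hpq) <;>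
      (have c2 := congrArg Prod.snd hpq) <;> (try simp only at c1 c2) <;>
      first
        | exact Prod.ext c1 c2
        | exact Prod.ext c2 c1
        | (exfalso; rw [c1, c2] at a; exact absurd a (not_lt_of_gt b))
  refine ⟨D.image o, ?_, ?_⟩
  · intro a b hab
    obtain ⟨p, hp, hpo⟩ := Finset.mem_image.1 hab
    have hadj : G.Adj a b := by
      rcases ho p with e | e <;> rw [e] at hpo
      · have := (hD p hp).1
        rw [hpo] at this
        exact this
      · have := (hD p hp).1.symm
        rw [Prod.ext_iff] at hpo
        simp only at hpo
        rw [hpo.1, hpo.2] at this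
        exact this
    refine ⟨hadj, fun hba => ?_⟩
    obtain ⟨q, hq, hqo⟩ := Finset.mem_image.1 hba
    have := hinj p hp q hq (Or.inr (by rw [hpo, hqo]))
    rw [this, hqo] at hpo
    exact hadj.ne (congrArg Prod.snd hpo)
  · intro X hX hX2
    have hXc : Xᶜ.Nonempty := by
      rw [Finset.nonempty_iff_ne_empty]
      intro he
      exact hX2 (by rwa [Finset.compl_eq_empty_iff] at he)
    have hXc2 : Xᶜ ≠ Finset.univ := by
      intro he
      rw [Finset.compl_eq_univ_iff] at he
      exact hX.ne_empty he
    refine (h2 Xᶜ hXc hXc2).trans ?_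
    unfold outC
    refine Finset.card_le_card_of_injOn o ?_ ?_
    · intro p hp
      simp only [Finset.coe_filter, Set.mem_setOf_eq, Finset.mem_compl] at hp ⊢
      refine ⟨Finset.mem_image_of_mem o hp.1, ?_⟩
      by_cases he : h p = p.2
      · simp only [o, he, if_true]
        rw [he] at hp
        tauto
      · have he' := (h1 p hp.1).resolve_right he
        simp only [o, he, if_false]
        rw [he'] at hp
        tauto
    · intro p hp q hq hpq
      simp only [Finset.coe_filter, Set.mem_setOf_eq] at hp hq
      exact hinj p hp.1 q hq.1 (Or.inl hpq)

lemma trees_exist (G : SimpleGraph V) (t : V) (k : ℕ) (hk : 1 ≤ k) (hconn : EdgeConnected G k) :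
    ∃ nxt rk, Trees G t (k / 2) nxt rk := by
  obtain ⟨O, hO, hout⟩ := orientation G k hk hconn
  let O' : Finset (V × V) := O.image Prod.swap
  have hO' : ∀ a b, (a, b) ∈ O' ↔ (b, a) ∈ O := by
    intro a b
    simp [O']
  have hout' : ∀ X : Finset V, X.Nonempty → X ≠ Finset.univ → k / 2 ≤ outC O' X := by
    intro X hX hX2
    have hXc : Xᶜ.Nonempty := by
      rw [Finset.nonempty_iff_ne_empty]
      intro he
      exact hX2 (by rwa [Finset.compl_eq_empty_iff] at he)
    have hXc2 : Xᶜ ≠ Finset.univ := by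
      intro he
      rw [Finset.compl_eq_univ_iff] at he
      exact hX.ne_empty he
    refine (hout Xᶜ hXc hXc2).trans ?_
    unfold outC
    refine Finset.card_le_card_of_injOn Prod.swap ?_ Prod.swap_injective.injOn
    rintro ⟨a, b⟩ hp
    simp only [Finset.coe_filter, Set.mem_setOf_eq, Finset.mem_compl, Prod.swap, hO'] at hp ⊢
    tauto
  have hne : ∀ X : Finset V, t ∉ X → X ≠ Finset.univ := by
    rintro X ht rfl
    exact ht (Finset.mem_univ t)
  obtain ⟨nL, rL, hL1, hL2⟩ := edmonds t (k / 2) O' (fun X hX ht => hout' X hX (hne X ht))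
  obtain ⟨nR, rR, hR1, hR2⟩ := edmonds t (k / 2) O (fun X hX ht => hout X hX (hne X ht))
  set m := k / 2 with hm
  have hLO : ∀ i < m, ∀ v, v ≠ t → (nL i v, v) ∈ O := fun i hi v hv => (hO' _ _).1 (hL1 i hi v hv).1
  have hRO : ∀ i < m, ∀ v, v ≠ t → (v, nR i v) ∈ O := fun i hi v hv => (hR1 i hi v hv).1
  refine ⟨fun i => if i < m then nL i else nR (i - m), fun i => if i < m then rL i else rR (i - m),
    ?_, ?_, ?_, ?_, ?_⟩
  · intro i hi v hv
    by_cases h : i < m <;> simp only [h, if_true, if_false]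
    · exact (hO _ _ (hLO i h v hv)).1.symm
    · exact (hO _ _ (hRO (i - m) (by omega) v hv)).1
  · intro i hi v hv
    by_cases h : i < m <;> simp only [h, if_true, if_false]
    · exact (hL1 i h v hv).2
    · exact (hR1 (i - m) (by omega) v hv).2
  · intro i hi j hj v hv
    by_cases h : i < m <;> by_cases h' : j < m <;> simp only [h, h', if_true, if_false] <;>
      intro he
    · exact hL2 i h j h' v hv he
    · have a := hLO i h v hv
      have b := hRO (j - m) (by omega) v hv
      rw [← he] at b
      exact absurd b (hO _ _ a).2
    · have a := hLO j h' v hv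
      have b := hRO (i - m) (by omega) v hv
      rw [he] at b
      exact absurd b (hO _ _ a).2
    · have := hR2 (i - m) (by omega) (j - m) (by omega) v hv he
      omega
  · intro i hi j hj v w hv hw
    simp only [hi, hj, if_true]
    intro he
    rcases Sym2.eq_iff.1 he with ⟨rfl, e⟩ | ⟨e, e'⟩
    · exact hL2 i hi j hj v hv e
    · have a := hLO i hi v hv
      have b := hLO j hj w hw
      rw [← e] at b
      rw [e'] at a
      exact absurd b (hO _ _ a).2
  · intro i hi hi' j hj hj' v w hv hw
    simp only [not_lt.2 hi', not_lt.2 hj', if_false]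
    intro he
    rcases Sym2.eq_iff.1 he with ⟨rfl, e⟩ | ⟨e, e'⟩
    · have := hR2 (i - m) (by omega) (j - m) (by omega) v hv e
      omega
    · have a := hRO (i - m) (by omega) v hv
      have b := hRO (j - m) (by omega) w hw
      rw [← e] at b
      rw [e'] at a
      exact absurd b (hO _ _ a).2

lemma zero_case (G : SimpleGraph V) (t : V) (hc : G.Connected) :
    ∃ P : FwdScheme G, DynResilient P t 0 := by
  have hstep : ∀ v, v ≠ t → ∃ w, G.Adj v w ∧ G.dist w t < G.dist v t := by
    intro v hv
    obtain ⟨w, hw⟩ := hc.exists_walk_length_eq_dist v t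
    cases w with
    | nil => exact absurd rfl hv
    | cons h q =>
      refine ⟨_, h, ?_⟩
      have := SimpleGraph.dist_le q
      rw [SimpleGraph.Walk.length_cons] at hw
      omega
  let P : FwdScheme G :=
    { fwd := fun v _ A => if h : ∃ w ∈ A, G.dist w t < G.dist v t then h.choose
        else if h' : A.Nonempty then h'.some else v
      mem := by
        intro v ip A hA
        split_ifs with h
        · exact h.choose_spec.1
        · exact hA.some_mem }
  refine ⟨P, ?_⟩
  intro F _ hF σ hσ s _ _
  by_contra hcon
  push Not at hcon
  have hF0 : F = ∅ := (Set.ncard_eq_zero (Set.toFinite F)).1 (Nat.le_zero.1 hF)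
  have hdec : ∀ n, G.dist (P.traj σ t s (n + 1)).1 t < G.dist (P.traj σ t s n).1 t := by
    intro n
    obtain ⟨w, hw, hd⟩ := hstep _ (hcon n)
    have hwA : w ∈ ({u : V | G.Adj (P.traj σ t s n).1 u ∧ s((P.traj σ t s n).1, u) ∉ σ n} : Set V) :=
      ⟨hw, fun h => by have := hσ n h; rw [hF0] at this; exact this⟩
    rw [FwdScheme.traj]
    rw [if_neg (hcon n), if_pos ⟨w, hwA⟩]
    simp only [P]
    have h : ∃ w' ∈ ({u : V | G.Adj (P.traj σ t s n).1 u ∧ s((P.traj σ t s n).1, u) ∉ σ n} : Set V),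
      G.dist w' t < G.dist (P.traj σ t s n).1 t := ⟨w, hwA, hd⟩
    rw [dif_pos h]
    exact h.choose_spec.2
  have hall : ∀ n, G.dist (P.traj σ t s n).1 t + n ≤ G.dist (P.traj σ t s 0).1 t := by
    intro n
    induction n with
    | zero => simp
    | succ n ih => have := hdec n; omega
  have := hall (G.dist (P.traj σ t s 0).1 t + 1)
  omega

/-- Theorem 4: for every `k ≥ 1`, every finite `k`-edge-connected graph with
destination `t` admits a routing process that is `⌊k/2⌋`-resilient against
dynamic failures. -/
theorem half_connectivity_resilient
    (G : SimpleGraph V) (t : V) (k : ℕ) (hk : 1 ≤ k) (hconn : EdgeConnected G k) :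
    ∃ P : FwdScheme G, DynResilient P t (k / 2) := by
  rcases Nat.eq_zero_or_pos (k / 2) with h | h
  · rw [h]
    apply zero_case
    have := hconn ∅ (Set.empty_subset _) (by simp)
    simpa using this
  · obtain ⟨nxt, rk, hT⟩ := trees_exist G t k hk hconn
    exact ⟨_, scheme_resilient h hT⟩

end FRR
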